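/- arXiv:math/0701604 — 4 statements merged into one kernel-verified Lean document; each statement's English description precedes it below -/
import Mathlib

section
/- Second variation of the metric coefficients: with torsion coefficients T_{σ,i}^ω, the second variations of h̃_ij := ⟨X̃_{u^i}, X̃_{u^j}⟩ along N_γ̂ are δ²h₁₁ = 2φ_u² + (2/W)φ²(L_{γ̂,11}² + L_{γ̂,12}²) + 2φ² Σ_σ (γ̂_u^σ + γ̂^ω T_{ω,1}^σ)², δ²h₁₂ = 2φ_uφ_v + (2/W)φ²(L_{γ̂,11}+L_{γ̂,22})L_{γ̂,12} + 2φ² Σ_σ (γ̂_u^σ + γ̂^ω T_{ω,1}^σ)(γ̂_v^σ + γ̂^ω T_{ω,2}^σ), and δ²h₂₂ = 2φ_v² + (2/W)φ²(L_{γ̂,12}² + L_{γ̂,22}²) + 2φ² Σ_σ (γ̂_v^σ + γ̂^ω T_{ω,2}^σ)², where summation over the repeated index ω runs from 1 to n−2. -/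
open scoped RealInnerProductSpace BigOperators
open MeasureTheory

noncomputable section

/-- Partial derivative in the first coordinate direction `u`. -/
def pdu {F : Type*} [NormedAddCommGroup F] [NormedSpace ℝ F]
    (f : ℝ × ℝ → F) (p : ℝ × ℝ) : F :=
  fderiv ℝ f p (1, 0)

/-- Partial derivative in the second coordinate direction `v`. -/
def pdv {F : Type*} [NormedAddCommGroup F] [NormedSpace ℝ F]
    (f : ℝ × ℝ → F) (p : ℝ × ℝ) : F :=
  fderiv ℝ f p (0, 1)

/-- The closed unit disc `B ⊆ ℝ²`. -/
def Disc : Set (ℝ × ℝ) := Metric.closedBall 0 1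

/-- Coefficient `L_{N,11} = ⟨X_uu, N⟩` of the second fundamental form. -/
def L11 {d : ℕ} (X Nσ : ℝ × ℝ → EuclideanSpace ℝ (Fin d)) (p : ℝ × ℝ) : ℝ :=
  ⟪pdu (pdu X) p, Nσ p⟫

/-- Coefficient `L_{N,12} = ⟨X_uv, N⟩` of the second fundamental form. -/
def L12 {d : ℕ} (X Nσ : ℝ × ℝ → EuclideanSpace ℝ (Fin d)) (p : ℝ × ℝ) : ℝ :=
  ⟪pdv (pdu X) p, Nσ p⟫

/-- Coefficient `L_{N,22} = ⟨X_vv, N⟩` of the second fundamental form. -/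
def L22 {d : ℕ} (X Nσ : ℝ × ℝ → EuclideanSpace ℝ (Fin d)) (p : ℝ × ℝ) : ℝ :=
  ⟪pdv (pdv X) p, Nσ p⟫

/-- Torsion coefficient `T_{σ,1}^ω = ⟨N_{σ,u}, N_ω⟩` (set to `0` when `σ = ω`). -/
def Tor1 {d k : ℕ} (N : Fin k → ℝ × ℝ → EuclideanSpace ℝ (Fin d)) (σ ω : Fin k)
    (q : ℝ × ℝ) : ℝ :=
  if σ = ω then 0 else ⟪pdu (N σ) q, N ω q⟫

/-- Torsion coefficient `T_{σ,2}^ω = ⟨N_{σ,v}, N_ω⟩` (set to `0` when `σ = ω`). -/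
def Tor2 {d k : ℕ} (N : Fin k → ℝ × ℝ → EuclideanSpace ℝ (Fin d)) (σ ω : Fin k)
    (q : ℝ × ℝ) : ℝ :=
  if σ = ω then 0 else ⟪pdv (N σ) q, N ω q⟫

/-- The normal variation `X̃ = X + ε φ N_γ̂` with `N_γ̂ = ∑_σ γ̂^σ N_σ`. -/
def Xvar {d k : ℕ} (X : ℝ × ℝ → EuclideanSpace ℝ (Fin d)) (φ : ℝ × ℝ → ℝ)
    (γ : Fin k → ℝ × ℝ → ℝ) (N : Fin k → ℝ × ℝ → EuclideanSpace ℝ (Fin d))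
    (ε : ℝ) (q : ℝ × ℝ) : EuclideanSpace ℝ (Fin d) :=
  X q + (ε * φ q) • ∑ σ, γ σ q • N σ q

/-- The normal field `N_γ̂ = ∑_σ γ̂^σ N_σ`. -/
def weightedNormal {d k : ℕ} (γ : Fin k → ℝ × ℝ → ℝ)
    (N : Fin k → ℝ × ℝ → EuclideanSpace ℝ (Fin d)) (q : ℝ × ℝ) : EuclideanSpace ℝ (Fin d) :=
  ∑ σ, γ σ q • N σ q

section General

variable {E : Type*} [NormedAddCommGroup E] [InnerProductSpace ℝ E]

/-- The second derivative of the inner product of two affine curves. -/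
theorem iteratedDeriv_two_inner_affine (A a B b : E) :
    iteratedDeriv 2 (fun ε : ℝ => ⟪A + ε • a, B + ε • b⟫) 0 = 2 * ⟪a, b⟫ := by
  have hexp : (fun ε : ℝ => ⟪A + ε • a, B + ε • b⟫)
      = fun ε : ℝ => ⟪A, B⟫ + ε * (⟪A, b⟫ + ⟪a, B⟫) + ε ^ 2 * ⟪a, b⟫ := by
    funext ε
    simp only [inner_add_left, inner_add_right, real_inner_smul_left, real_inner_smul_right]
    ring
  have hderiv : deriv (fun ε : ℝ => ⟪A, B⟫ + ε * (⟪A, b⟫ + ⟪a, B⟫) + ε ^ 2 * ⟪a, b⟫)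
      = fun ε : ℝ => (⟪A, b⟫ + ⟪a, B⟫) + ε * (2 * ⟪a, b⟫) := by
    funext ε
    have h := (((hasDerivAt_id ε).mul_const (⟪A, b⟫ + ⟪a, B⟫)).const_add ⟪A, B⟫).add
      (((hasDerivAt_id ε).pow 2).mul_const ⟪a, b⟫)
    refine h.deriv.trans ?_
    simp
    ring
  rw [hexp, iteratedDeriv_succ, iteratedDeriv_one, hderiv]
  have h := ((hasDerivAt_id (0 : ℝ)).mul_const (2 * ⟪a, b⟫)).const_add (⟪A, b⟫ + ⟪a, B⟫)
  refine h.deriv.trans ?_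
  simp

/-- Differentiating a locally constant inner product. -/
theorem inner_fderiv_of_eventually_const {G : Type*} [NormedAddCommGroup G] [NormedSpace ℝ G]
    {f g : G → E} {p : G} {c : ℝ} (hf : DifferentiableAt ℝ f p) (hg : DifferentiableAt ℝ g p)
    (hc : ∀ᶠ q in nhds p, ⟪f q, g q⟫ = c) (d : G) :
    ⟪f p, fderiv ℝ g p d⟫ + ⟪fderiv ℝ f p d, g p⟫ = 0 := by
  rw [← fderiv_inner_apply ℝ hf hg, Filter.EventuallyEq.fderiv_eq (f := fun _ => c) hc]
  simp

/-- Parseval's identity for an orthogonal frame consisting of orthonormal vectors `N σ` and two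
vectors `x`, `y` of squared length `w`. -/
theorem inner_eq_of_conformal_frame [FiniteDimensional ℝ E] {k : ℕ} (N : Fin k → E) (x y : E)
    (w : ℝ) (hw : 0 < w) (hdim : Module.finrank ℝ E = k + 2)
    (hx : ⟪x, x⟫ = w) (hy : ⟪y, y⟫ = w) (hxy : ⟪x, y⟫ = 0)
    (hxN : ∀ σ, ⟪x, N σ⟫ = 0) (hyN : ∀ σ, ⟪y, N σ⟫ = 0)
    (hN : ∀ σ ω, ⟪N σ, N ω⟫ = if σ = ω then 1 else 0) (a b : E) :
    ⟪a, b⟫ = ∑ σ, ⟪a, N σ⟫ * ⟪b, N σ⟫ + (1 / w) * (⟪a, x⟫ * ⟪b, x⟫ + ⟪a, y⟫ * ⟪b, y⟫) := by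
  set s : ℝ := (√w)⁻¹ with hs
  have hss : s * s = 1 / w := by
    rw [hs, ← mul_inv, Real.mul_self_sqrt hw.le, one_div]
  have hssw : s * (s * w) = 1 := by
    rw [← mul_assoc, hss, one_div, inv_mul_cancel₀ hw.ne']
  let e : Fin k ⊕ Fin 2 → E := Sum.elim N ![s • x, s • y]
  have hNx : ∀ σ, ⟪N σ, x⟫ = 0 := fun σ => by rw [real_inner_comm, hxN]
  have hNy : ∀ σ, ⟪N σ, y⟫ = 0 := fun σ => by rw [real_inner_comm, hyN]
  have hyx : ⟪y, x⟫ = 0 := by rw [real_inner_comm, hxy]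
  have he : Orthonormal ℝ e := by
    rw [orthonormal_iff_ite]
    rintro (σ | i) (ω | j)
    · simp [e, hN]
    · fin_cases j <;> simp [e, real_inner_smul_right, hNx, hNy]
    · fin_cases i <;> simp [e, real_inner_smul_left, hxN, hyN]
    · have hxx' : ⟪s • x, s • x⟫ = 1 := by
        rw [real_inner_smul_left, real_inner_smul_right, hx, hssw]
      have hyy' : ⟪s • y, s • y⟫ = 1 := by
        rw [real_inner_smul_left, real_inner_smul_right, hy, hssw]
      have hxy' : ⟪s • x, s • y⟫ = 0 := by
        rw [real_inner_smul_left, real_inner_smul_right, hxy, mul_zero, mul_zero]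
      have hyx' : ⟪s • y, s • x⟫ = 0 := by rw [real_inner_comm, hxy']
      fin_cases i <;> fin_cases j
      · exact hxx'
      · exact hxy'
      · exact hyx'
      · exact hyy'
  have hcard : Fintype.card (Fin k ⊕ Fin 2) = Module.finrank ℝ E := by simp [hdim]
  have hspan : ⊤ ≤ Submodule.span ℝ (Set.range e) :=
    (he.linearIndependent.span_eq_top_of_card_eq_finrank' hcard).ge
  have h := (OrthonormalBasis.mk he hspan).sum_inner_mul_inner a b
  rw [← h, Fintype.sum_sum_type]
  simp only [OrthonormalBasis.coe_mk, e, Sum.elim_inl, Sum.elim_inr, Fin.sum_univ_two]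
  congr 1
  · exact Finset.sum_congr rfl fun σ _ => by rw [real_inner_comm b]
  · simp only [Matrix.cons_val_zero, Matrix.cons_val_one, real_inner_smul_left,
      real_inner_smul_right]
    rw [← hss, real_inner_comm b x, real_inner_comm b y]
    ring

end General

section Frame

variable {d k : ℕ} {X : ℝ × ℝ → EuclideanSpace ℝ (Fin d)}
  {N : Fin k → ℝ × ℝ → EuclideanSpace ℝ (Fin d)} {γ : Fin k → ℝ × ℝ → ℝ} {φ : ℝ × ℝ → ℝ}
  {p : ℝ × ℝ}

theorem weightedNormal_differentiableAt (hγ : ∀ σ, DifferentiableAt ℝ (γ σ) p)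
    (hN : ∀ σ, DifferentiableAt ℝ (N σ) p) : DifferentiableAt ℝ (weightedNormal γ N) p := by
  unfold weightedNormal
  exact DifferentiableAt.fun_sum fun σ _ => (hγ σ).smul (hN σ)

theorem fderiv_weightedNormal_apply (hγ : ∀ σ, DifferentiableAt ℝ (γ σ) p)
    (hN : ∀ σ, DifferentiableAt ℝ (N σ) p) (e : ℝ × ℝ) :
    fderiv ℝ (weightedNormal γ N) p e
      = ∑ σ, (γ σ p • fderiv ℝ (N σ) p e + fderiv ℝ (γ σ) p e • N σ p) := by
  unfold weightedNormal
  rw [fderiv_fun_sum fun σ _ => (hγ σ).fun_smul (hN σ), _root_.sum_apply]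
  refine Finset.sum_congr rfl fun σ _ => ?_
  rw [fderiv_fun_smul (hγ σ) (hN σ)]
  simp

theorem fderiv_Xvar_apply (hX : DifferentiableAt ℝ X p) (hφ : DifferentiableAt ℝ φ p)
    (hn : DifferentiableAt ℝ (weightedNormal γ N) p) (ε : ℝ) (e : ℝ × ℝ) :
    fderiv ℝ (Xvar X φ γ N ε) p e
      = fderiv ℝ X p e
        + ε • (fderiv ℝ φ p e • weightedNormal γ N p
          + φ p • fderiv ℝ (weightedNormal γ N) p e) := by
  have h : Xvar X φ γ N ε = fun q => X q + ε • (φ q • weightedNormal γ N q) := by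
    funext q
    simp only [Xvar, weightedNormal, mul_smul]
  rw [h, fderiv_fun_add hX ((hφ.fun_smul hn).fun_const_smul ε), fderiv_fun_const_smul (hφ.fun_smul hn),
    fderiv_fun_smul hφ hn]
  simp [add_comm]

/-- The second variation of `⟨X̃_d, X̃_e⟩`, in terms of the derivatives of a unit normal field. -/
theorem iteratedDeriv_two_inner_fderiv_Xvar (hX : DifferentiableAt ℝ X p)
    (hφ : DifferentiableAt ℝ φ p) (hn : DifferentiableAt ℝ (weightedNormal γ N) p)
    (hunit : ∀ᶠ q in nhds p, ⟪weightedNormal γ N q, weightedNormal γ N q⟫ = 1) (e e' : ℝ × ℝ) :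
    iteratedDeriv 2 (fun ε : ℝ =>
        ⟪fderiv ℝ (Xvar X φ γ N ε) p e, fderiv ℝ (Xvar X φ γ N ε) p e'⟫) 0
      = 2 * (fderiv ℝ φ p e * fderiv ℝ φ p e')
        + 2 * (φ p) ^ 2 * ⟪fderiv ℝ (weightedNormal γ N) p e,
            fderiv ℝ (weightedNormal γ N) p e'⟫ := by
  simp only [fderiv_Xvar_apply hX hφ hn]
  rw [iteratedDeriv_two_inner_affine]
  have horth : ∀ c, ⟪weightedNormal γ N p, fderiv ℝ (weightedNormal γ N) p c⟫ = 0 := fun c => by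
    have h := inner_fderiv_of_eventually_const hn hn hunit c
    rw [real_inner_comm (weightedNormal γ N p) (fderiv ℝ (weightedNormal γ N) p c)] at h
    linarith
  simp only [inner_add_left, inner_add_right, real_inner_smul_left, real_inner_smul_right,
    hunit.self_of_nhds, horth, real_inner_comm (weightedNormal γ N p)]
  ring

/-- The normal components of the derivative of `N_γ̂`. -/
theorem inner_fderiv_weightedNormal_normal (hγ : ∀ σ, DifferentiableAt ℝ (γ σ) p)
    (hN : ∀ σ, DifferentiableAt ℝ (N σ) p)
    (hNN : ∀ σ ω, ∀ᶠ q in nhds p, ⟪N σ q, N ω q⟫ = if σ = ω then 1 else 0)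
    (e : ℝ × ℝ) (σ : Fin k) :
    ⟪fderiv ℝ (weightedNormal γ N) p e, N σ p⟫
      = fderiv ℝ (γ σ) p e
        + ∑ ω, γ ω p * (if ω = σ then 0 else ⟪fderiv ℝ (N ω) p e, N σ p⟫) := by
  have hself : ⟪fderiv ℝ (N σ) p e, N σ p⟫ = 0 := by
    have h := inner_fderiv_of_eventually_const (hN σ) (hN σ) (hNN σ σ) e
    rw [real_inner_comm (fderiv ℝ (N σ) p e) (N σ p)] at h
    linarith [real_inner_comm (fderiv ℝ (N σ) p e) (N σ p)]
  rw [fderiv_weightedNormal_apply hγ hN, sum_inner]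
  simp only [inner_add_left, real_inner_smul_left, fun ω => (hNN ω σ).self_of_nhds]
  rw [Finset.sum_add_distrib, add_comm]
  congr 1
  · simp
  · refine Finset.sum_congr rfl fun ω _ => ?_
    split_ifs with h
    · rw [h, hself]
    · rfl

/-- The tangential components of the derivative of `N_γ̂`. -/
theorem inner_fderiv_weightedNormal_tangent {Y : ℝ × ℝ → EuclideanSpace ℝ (Fin d)}
    (hY : DifferentiableAt ℝ Y p) (hn : DifferentiableAt ℝ (weightedNormal γ N) p)
    (hYN : ∀ᶠ q in nhds p, ⟪Y q, weightedNormal γ N q⟫ = 0) (e : ℝ × ℝ) :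
    ⟪fderiv ℝ (weightedNormal γ N) p e, Y p⟫
      = -∑ σ, γ σ p * ⟪fderiv ℝ Y p e, N σ p⟫ := by
  have h := inner_fderiv_of_eventually_const hY hn hYN e
  have hsum : ⟪fderiv ℝ Y p e, weightedNormal γ N p⟫
      = ∑ σ, γ σ p * ⟪fderiv ℝ Y p e, N σ p⟫ := by
    simp only [weightedNormal, inner_sum, real_inner_smul_right]
  rw [real_inner_comm, ← hsum]
  linarith

theorem inner_weightedNormal_eq_zero {y : EuclideanSpace ℝ (Fin d)}
    (h : ∀ σ, ⟪y, N σ p⟫ = 0) : ⟪y, weightedNormal γ N p⟫ = 0 := by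
  simp [weightedNormal, inner_sum, real_inner_smul_right, h]

theorem inner_weightedNormal_self
    (hNN : ∀ σ ω, ⟪N σ p, N ω p⟫ = if σ = ω then 1 else 0) :
    ⟪weightedNormal γ N p, weightedNormal γ N p⟫ = ∑ σ, (γ σ p) ^ 2 := by
  simp only [weightedNormal, inner_sum, sum_inner, real_inner_smul_left, real_inner_smul_right,
    hNN]
  simp [sq]

end Frame

theorem pdu_differentiableAt {F : Type*} [NormedAddCommGroup F] [NormedSpace ℝ F]
    {f : ℝ × ℝ → F} {p : ℝ × ℝ} (hf : ContDiffAt ℝ 2 f p) : DifferentiableAt ℝ (pdu f) p := by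
  have h : ContDiffAt ℝ 1 (fderiv ℝ f) p := hf.fderiv_right (by norm_num)
  exact (h.differentiableAt (by norm_num)).clm_apply (differentiableAt_const _)

theorem pdv_differentiableAt {F : Type*} [NormedAddCommGroup F] [NormedSpace ℝ F]
    {f : ℝ × ℝ → F} {p : ℝ × ℝ} (hf : ContDiffAt ℝ 2 f p) : DifferentiableAt ℝ (pdv f) p := by
  have h : ContDiffAt ℝ 1 (fderiv ℝ f) p := hf.fderiv_right (by norm_num)
  exact (h.differentiableAt (by norm_num)).clm_apply (differentiableAt_const _)

/-- Symmetry of the mixed second partial derivatives. -/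
theorem pdu_pdv_comm {F : Type*} [NormedAddCommGroup F] [NormedSpace ℝ F]
    {f : ℝ × ℝ → F} {p : ℝ × ℝ} (hf : ContDiffAt ℝ 2 f p) :
    pdu (pdv f) p = pdv (pdu f) p := by
  have h : ContDiffAt ℝ 1 (fderiv ℝ f) p := hf.fderiv_right (by norm_num)
  have hd : DifferentiableAt ℝ (fderiv ℝ f) p := h.differentiableAt (by norm_num)
  have hsymm : IsSymmSndFDerivAt ℝ f p := hf.isSymmSndFDerivAt (by simp)
  have happ : ∀ a b : ℝ × ℝ,
      fderiv ℝ (fun q => fderiv ℝ f q a) p b = fderiv ℝ (fderiv ℝ f) p b a := fun a b => by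
    rw [fderiv_clm_apply hd (differentiableAt_const _)]
    simp
  unfold pdu pdv
  rw [happ, happ]
  exact hsymm _ _

/-- Where the variation function vanishes locally, the second variation vanishes. -/
theorem iteratedDeriv_two_inner_fderiv_Xvar_of_eventually_zero {d k : ℕ}
    (X : ℝ × ℝ → EuclideanSpace ℝ (Fin d)) (N : Fin k → ℝ × ℝ → EuclideanSpace ℝ (Fin d))
    (γ : Fin k → ℝ × ℝ → ℝ) {φ : ℝ × ℝ → ℝ} {p : ℝ × ℝ}
    (hφ : ∀ᶠ q in nhds p, φ q = 0) (e e' : ℝ × ℝ) :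
    iteratedDeriv 2 (fun ε : ℝ =>
        ⟪fderiv ℝ (Xvar X φ γ N ε) p e, fderiv ℝ (Xvar X φ γ N ε) p e'⟫) 0 = 0 := by
  have h : ∀ ε, fderiv ℝ (Xvar X φ γ N ε) p = fderiv ℝ X p := fun ε =>
    Filter.EventuallyEq.fderiv_eq (hφ.mono fun q hq => by simp [Xvar, hq])
  simp only [h]
  simp [iteratedDeriv_const]

/-- Second variation of the metric coefficients. -/
theorem second_variation_metric_coefficients
    (m : ℕ)
    (X : ℝ × ℝ → EuclideanSpace ℝ (Fin (m + 3)))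
    (hX : ContDiffOn ℝ 3 X Disc)
    (W : ℝ × ℝ → ℝ)
    (hWpos : ∀ p ∈ Disc, 0 < W p)
    (hconfu : ∀ p ∈ Disc, ⟪pdu X p, pdu X p⟫ = W p)
    (hconfv : ∀ p ∈ Disc, ⟪pdv X p, pdv X p⟫ = W p)
    (hconfuv : ∀ p ∈ Disc, ⟪pdu X p, pdv X p⟫ = 0)
    (N : Fin (m + 1) → ℝ × ℝ → EuclideanSpace ℝ (Fin (m + 3)))
    (hN : ∀ σ, ContDiffOn ℝ 2 (N σ) Disc)
    (hNXu : ∀ σ, ∀ p ∈ Disc, ⟪pdu X p, N σ p⟫ = 0)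
    (hNXv : ∀ σ, ∀ p ∈ Disc, ⟪pdv X p, N σ p⟫ = 0)
    (hNN : ∀ σ ω, ∀ p ∈ Disc, ⟪N σ p, N ω p⟫ = if σ = ω then 1 else 0)
    (γ : Fin (m + 1) → ℝ × ℝ → ℝ)
    (hγ : ∀ σ, ContDiffOn ℝ 2 (γ σ) Disc)
    (hγunit : ∀ p ∈ Disc, (∑ σ, (γ σ p) ^ 2) = 1)
    (φ : ℝ × ℝ → ℝ)
    (hφ : ContDiff ℝ (⊤ : ℕ∞) φ)
    (hφsupp : tsupport φ ⊆ Metric.ball (0 : ℝ × ℝ) 1)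
    : ∀ p ∈ Disc,
      iteratedDeriv 2 (fun ε : ℝ =>
          ⟪pdu (Xvar X φ γ N ε) p, pdu (Xvar X φ γ N ε) p⟫) 0
        = 2 * (pdu φ p) ^ 2
          + (2 / W p) * (φ p) ^ 2 *
            ((∑ σ, γ σ p * L11 X (N σ) p) ^ 2 + (∑ σ, γ σ p * L12 X (N σ) p) ^ 2)
          + 2 * (φ p) ^ 2 *
            (∑ σ, (pdu (γ σ) p + ∑ ω, γ ω p * Tor1 N ω σ p) ^ 2) ∧
      iteratedDeriv 2 (fun ε : ℝ =>
          ⟪pdu (Xvar X φ γ N ε) p, pdv (Xvar X φ γ N ε) p⟫) 0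
        = 2 * (pdu φ p) * (pdv φ p)
          + (2 / W p) * (φ p) ^ 2 *
            ((∑ σ, γ σ p * L11 X (N σ) p) + (∑ σ, γ σ p * L22 X (N σ) p)) *
            (∑ σ, γ σ p * L12 X (N σ) p)
          + 2 * (φ p) ^ 2 *
            (∑ σ, (pdu (γ σ) p + ∑ ω, γ ω p * Tor1 N ω σ p) *
              (pdv (γ σ) p + ∑ ω, γ ω p * Tor2 N ω σ p)) ∧
      iteratedDeriv 2 (fun ε : ℝ =>
          ⟪pdv (Xvar X φ γ N ε) p, pdv (Xvar X φ γ N ε) p⟫) 0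
        = 2 * (pdv φ p) ^ 2
          + (2 / W p) * (φ p) ^ 2 *
            ((∑ σ, γ σ p * L12 X (N σ) p) ^ 2 + (∑ σ, γ σ p * L22 X (N σ) p) ^ 2)
          + 2 * (φ p) ^ 2 *
            (∑ σ, (pdv (γ σ) p + ∑ ω, γ ω p * Tor2 N ω σ p) ^ 2) := by
  intro p hp
  by_cases hpb : p ∈ Metric.ball (0 : ℝ × ℝ) 1
  · have hdisc : Disc ∈ nhds p :=
      Filter.mem_of_superset (Metric.isOpen_ball.mem_nhds hpb) Metric.ball_subset_closedBall
    have hX2 : ContDiffAt ℝ 2 X p := (hX.contDiffAt hdisc).of_le (by norm_num)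
    have hXd : DifferentiableAt ℝ X p := hX2.differentiableAt (by norm_num)
    have hφd : DifferentiableAt ℝ φ p := hφ.contDiffAt.differentiableAt (by simp)
    have hNd : ∀ σ, DifferentiableAt ℝ (N σ) p := fun σ =>
      ((hN σ).contDiffAt hdisc).differentiableAt (by norm_num)
    have hγd : ∀ σ, DifferentiableAt ℝ (γ σ) p := fun σ =>
      ((hγ σ).contDiffAt hdisc).differentiableAt (by norm_num)
    have hn := weightedNormal_differentiableAt hγd hNd
    have hunit : ∀ᶠ q in nhds p, ⟪weightedNormal γ N q, weightedNormal γ N q⟫ = 1 := by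
      filter_upwards [hdisc] with q hq
      rw [inner_weightedNormal_self fun σ ω => hNN σ ω q hq, hγunit q hq]
    have hNNe : ∀ σ ω, ∀ᶠ q in nhds p, ⟪N σ q, N ω q⟫ = if σ = ω then 1 else 0 := fun σ ω =>
      Filter.mem_of_superset hdisc fun q hq => hNN σ ω q hq
    have hun : ∀ᶠ q in nhds p, ⟪pdu X q, weightedNormal γ N q⟫ = 0 :=
      Filter.mem_of_superset hdisc fun q hq =>
        inner_weightedNormal_eq_zero fun σ => hNXu σ q hq
    have hvn : ∀ᶠ q in nhds p, ⟪pdv X q, weightedNormal γ N q⟫ = 0 :=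
      Filter.mem_of_superset hdisc fun q hq =>
        inner_weightedNormal_eq_zero fun σ => hNXv σ q hq
    have hparseval := inner_eq_of_conformal_frame (fun σ => N σ p) (pdu X p) (pdv X p) (W p)
      (hWpos p hp) (by simp) (hconfu p hp) (hconfv p hp) (hconfuv p hp)
      (fun σ => hNXu σ p hp) (fun σ => hNXv σ p hp) (fun σ ω => hNN σ ω p hp)
    have hnu : ∀ σ, ⟪fderiv ℝ (weightedNormal γ N) p (1, 0), N σ p⟫
        = pdu (γ σ) p + ∑ ω, γ ω p * Tor1 N ω σ p :=
      inner_fderiv_weightedNormal_normal hγd hNd hNNe (1, 0)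
    have hnv : ∀ σ, ⟪fderiv ℝ (weightedNormal γ N) p (0, 1), N σ p⟫
        = pdv (γ σ) p + ∑ ω, γ ω p * Tor2 N ω σ p :=
      inner_fderiv_weightedNormal_normal hγd hNd hNNe (0, 1)
    have huu : ⟪fderiv ℝ (weightedNormal γ N) p (1, 0), pdu X p⟫
        = -∑ σ, γ σ p * L11 X (N σ) p :=
      inner_fderiv_weightedNormal_tangent (pdu_differentiableAt hX2) hn hun (1, 0)
    have hvu : ⟪fderiv ℝ (weightedNormal γ N) p (0, 1), pdu X p⟫
        = -∑ σ, γ σ p * L12 X (N σ) p :=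
      inner_fderiv_weightedNormal_tangent (pdu_differentiableAt hX2) hn hun (0, 1)
    have huv : ⟪fderiv ℝ (weightedNormal γ N) p (1, 0), pdv X p⟫
        = -∑ σ, γ σ p * L12 X (N σ) p := by
      unfold L12
      rw [← pdu_pdv_comm hX2]
      exact inner_fderiv_weightedNormal_tangent (pdv_differentiableAt hX2) hn hvn (1, 0)
    have hvv : ⟪fderiv ℝ (weightedNormal γ N) p (0, 1), pdv X p⟫
        = -∑ σ, γ σ p * L22 X (N σ) p :=
      inner_fderiv_weightedNormal_tangent (pdv_differentiableAt hX2) hn hvn (0, 1)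
    have hvar := iteratedDeriv_two_inner_fderiv_Xvar hXd hφd hn hunit
    refine ⟨(hvar (1, 0) (1, 0)).trans ?_, (hvar (1, 0) (0, 1)).trans ?_,
      (hvar (0, 1) (0, 1)).trans ?_⟩
    · rw [hparseval]
      simp only [hnu, huu, huv, ← sq]
      unfold pdu
      ring
    · rw [hparseval]
      simp only [hnu, hnv, huu, huv, hvu, hvv]
      unfold pdu pdv
      ring
    · rw [hparseval]
      simp only [hnv, hvu, hvv, ← sq]
      unfold pdv
      ring
  · have hφ0 : ∀ᶠ q in nhds p, φ q = 0 :=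
      notMem_tsupport_iff_eventuallyEq.mp fun h => hpb (hφsupp h)
    have hφp : φ p = 0 := hφ0.self_of_nhds
    have hdφ : fderiv ℝ φ p = 0 := by
      rw [Filter.EventuallyEq.fderiv_eq (f := fun _ => (0 : ℝ)) hφ0]
      simp
    have hvar := iteratedDeriv_two_inner_fderiv_Xvar_of_eventually_zero X N γ hφ0
    refine ⟨(hvar (1, 0) (1, 0)).trans ?_, (hvar (1, 0) (0, 1)).trans ?_,
      (hvar (0, 1) (0, 1)).trans ?_⟩ <;>
    simp [pdu, pdv, hφp, hdφ]
end
end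

section
/- Second variation of the area element: with W̃ := √(h̃₁₁h̃₂₂ − h̃₁₂²) where h̃_ij := ⟨X̃_{u^i}, X̃_{u^j}⟩, the second variation along N_γ̂ satisfies δ²W = |∇φ|² + 2 K_γ̂ W φ² + Σ_σ { (γ̂_u^σ + γ̂^ω T_{ω,1}^σ)² + (γ̂_v^σ + γ̂^ω T_{ω,2}^σ)² } φ² at every point of B, for arbitrary φ ∈ C₀^∞(B,ℝ), where K_γ̂ := (L_{γ̂,11}L_{γ̂,22} − L_{γ̂,12}²)/W² is the Gaussian curvature with respect to N_γ̂ and summation over the repeated index ω runs from 1 to n−2. -/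
open scoped RealInnerProductSpace BigOperators
open MeasureTheory

noncomputable section

/-- The second derivative of the square root of a positive function. -/
lemma iteratedDeriv_two_sqrt {f f' : ℝ → ℝ} {f'' x w : ℝ} (hw : 0 < w) (hfx : f x = w ^ 2)
    (hf : ∀ t, HasDerivAt f (f' t) t) (hf' : HasDerivAt f' f'' x) :
    iteratedDeriv 2 (fun t => √(f t)) x = f'' / (2 * w) - f' x ^ 2 / (4 * w ^ 3) := by
  have hsq : √(f x) = w := by rw [hfx, Real.sqrt_sq hw.le]
  have hpos : 0 < f x := by rw [hfx]; positivity
  have hev : deriv (fun t => √(f t)) =ᶠ[nhds x] fun t => f' t / (2 * √(f t)) := by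
    filter_upwards [(hf x).continuousAt.eventually (lt_mem_nhds hpos)] with t ht
    exact ((hf t).sqrt ht.ne').deriv
  have hden : HasDerivAt (fun t => 2 * √(f t)) (2 * (f' x / (2 * √(f x)))) x :=
    ((hf x).sqrt hpos.ne').const_mul 2
  have hne : 2 * √(f x) ≠ 0 := by rw [hsq]; positivity
  rw [iteratedDeriv_succ, iteratedDeriv_one, hev.deriv_eq, (hf'.fun_div hden hne).deriv, hsq]
  field_simp
  ring

/-- The second variation of the area element of a pencil of first fundamental forms which is
conformal at parameter `0`. -/
lemma iteratedDeriv_two_sqrt_gram {w : ℝ} (hw : 0 < w) (p q r a b c : ℝ) :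
    iteratedDeriv 2 (fun t : ℝ => √((w + 2 * t * p + t ^ 2 * a) * (w + 2 * t * q + t ^ 2 * b) -
        (2 * t * r + t ^ 2 * c) ^ 2)) 0
      = a + b + 4 * (p * q - r ^ 2) / w - (p + q) ^ 2 / w := by
  have hquad : ∀ w p a t : ℝ,
      HasDerivAt (fun t : ℝ => w + 2 * t * p + t ^ 2 * a) (2 * p + 2 * t * a) t := by
    intro w p a t
    have h := ((((hasDerivAt_id' t).const_mul 2).mul_const p).const_add w).fun_add
      (((hasDerivAt_id' t).fun_pow 2).mul_const a)
    exact h.congr_deriv (by simp)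
  have hlin : ∀ p a : ℝ, HasDerivAt (fun t : ℝ => 2 * p + 2 * t * a) (2 * a) 0 := by
    intro p a
    simpa using (((hasDerivAt_id (0 : ℝ)).const_mul 2).mul_const a).const_add (2 * p)
  have hquad' : ∀ t, HasDerivAt (fun t : ℝ => 2 * t * r + t ^ 2 * c) (2 * r + 2 * t * c) t := by
    intro t
    simpa using hquad 0 r c t
  rw [iteratedDeriv_two_sqrt hw (by ring)
    (fun t => ((hquad w p a t).fun_mul (hquad w q b t)).fun_sub ((hquad' t).fun_pow 2))
    ((((hlin p a).fun_mul (hquad w q b 0)).fun_add ((hquad w p a 0).fun_mul (hlin q b))).fun_sub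
      ((((hquad' 0).fun_pow (2 - 1)).const_mul ((2 : ℕ) : ℝ)).fun_mul (hlin r c)))]
  simp
  field_simp
  ring

/-- Parseval's identity in an orthogonal frame made of two vectors of equal length and of
unit vectors. -/
lemma norm_sq_eq_of_conformal_frame {m : ℕ} {e f v : EuclideanSpace ℝ (Fin (m + 3))}
    {N : Fin (m + 1) → EuclideanSpace ℝ (Fin (m + 3))} {w : ℝ} (hw : 0 < w)
    (he : ⟪e, e⟫ = w) (hf : ⟪f, f⟫ = w) (hef : ⟪e, f⟫ = 0)
    (heN : ∀ σ, ⟪e, N σ⟫ = 0) (hfN : ∀ σ, ⟪f, N σ⟫ = 0)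
    (hN : ∀ σ ω, ⟪N σ, N ω⟫ = if σ = ω then 1 else 0) :
    ⟪v, v⟫ = (⟪v, e⟫ ^ 2 + ⟪v, f⟫ ^ 2) / w + ∑ σ, ⟪v, N σ⟫ ^ 2 := by
  have hs : (√w)⁻¹ * ((√w)⁻¹ * w) = 1 := by
    have := Real.mul_self_sqrt hw.le
    have h0 : √w ≠ 0 := (Real.sqrt_pos.2 hw).ne'
    field_simp
    nlinarith
  let b : Option (Option (Fin (m + 1))) → EuclideanSpace ℝ (Fin (m + 3)) := fun i =>
    i.elim ((√w)⁻¹ • e) fun j => j.elim ((√w)⁻¹ • f) N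
  have hb : Orthonormal ℝ b := by
    rw [orthonormal_iff_ite]
    rintro (_ | _ | σ) (_ | _ | ω) <;>
      simp [b, inner_smul_left, inner_smul_right, he, hf, hef, heN, hfN, hN, hs,
        real_inner_comm e, real_inner_comm f, -inner_self_eq_norm_sq_to_K]
  let B : OrthonormalBasis (Option (Option (Fin (m + 1)))) ℝ (EuclideanSpace ℝ (Fin (m + 3))) :=
    OrthonormalBasis.mk hb (hb.linearIndependent.span_eq_top_of_card_eq_finrank' (by simp)).ge
  have hB := B.sum_sq_inner_left v
  rw [real_inner_self_eq_norm_sq, ← hB]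
  have hs2 : ((√w)⁻¹) ^ 2 = w⁻¹ := by rw [inv_pow, Real.sq_sqrt hw.le]
  simp [B, b, Fintype.sum_option, inner_smul_right, mul_pow, hs2]
  ring

/-- Differentiating a locally constant inner product. -/
lemma inner_fderiv_add_inner_fderiv_eq_zero {E F : Type*} [NormedAddCommGroup E]
    [NormedSpace ℝ E] [NormedAddCommGroup F] [InnerProductSpace ℝ F] {f g : E → F} {p : E}
    {c : ℝ} (hf : DifferentiableAt ℝ f p) (hg : DifferentiableAt ℝ g p)
    (hc : (fun q => ⟪f q, g q⟫) =ᶠ[nhds p] fun _ => c) (d : E) :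
    ⟪f p, fderiv ℝ g p d⟫ + ⟪fderiv ℝ f p d, g p⟫ = 0 := by
  rw [← fderiv_inner_apply ℝ hf hg, hc.fderiv_eq]
  simp

lemma fderiv_fderiv_apply_comm {E F : Type*} [NormedAddCommGroup E] [NormedSpace ℝ E]
    [NormedAddCommGroup F] [NormedSpace ℝ F] {f : E → F} {p : E} (hf : ContDiffAt ℝ 2 f p)
    (d e : E) :
    fderiv ℝ (fun q => fderiv ℝ f q d) p e = fderiv ℝ (fun q => fderiv ℝ f q e) p d := by
  have hd : DifferentiableAt ℝ (fderiv ℝ f) p :=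
    (hf.fderiv_right (m := 1) (by norm_num)).differentiableAt (by norm_num)
  have hsymm : IsSymmSndFDerivAt ℝ f p := hf.isSymmSndFDerivAt (by simp)
  simpa [fderiv_clm_apply hd (differentiableAt_const _)] using hsymm e d

/-- The second variation of the area element for a variation `X + ε Y`, expressed through the
derivatives of `Y` at a point where `X` is conformal. -/
lemma iteratedDeriv_two_sqrt_gram_add_smul {F : Type*} [NormedAddCommGroup F]
    [InnerProductSpace ℝ F] {e f : F} {w : ℝ} (hw : 0 < w) (he : ⟪e, e⟫ = w) (hf : ⟪f, f⟫ = w)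
    (hef : ⟪e, f⟫ = 0) (y z : F) :
    iteratedDeriv 2 (fun t : ℝ => √(⟪e + t • y, e + t • y⟫ * ⟪f + t • z, f + t • z⟫ -
        ⟪e + t • y, f + t • z⟫ ^ 2)) 0
      = ⟪y, y⟫ + ⟪z, z⟫ + (4 * (⟪y, e⟫ * ⟪z, f⟫) - (⟪y, f⟫ + ⟪z, e⟫) ^ 2) / w
        - (⟪y, e⟫ + ⟪z, f⟫) ^ 2 / w := by
  have hfun : (fun t : ℝ => √(⟪e + t • y, e + t • y⟫ * ⟪f + t • z, f + t • z⟫ -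
        ⟪e + t • y, f + t • z⟫ ^ 2)) =
      fun t : ℝ => √((w + 2 * t * ⟪y, e⟫ + t ^ 2 * ⟪y, y⟫) *
        (w + 2 * t * ⟪z, f⟫ + t ^ 2 * ⟪z, z⟫) -
        (2 * t * ((⟪y, f⟫ + ⟪z, e⟫) / 2) + t ^ 2 * ⟪y, z⟫) ^ 2) := by
    funext t
    simp only [inner_add_left, inner_add_right, real_inner_smul_left, real_inner_smul_right, he,
      hf, hef, real_inner_comm y e, real_inner_comm z f, real_inner_comm z e]
    congr 1
    ring
  rw [hfun, iteratedDeriv_two_sqrt_gram hw]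
  ring

/-- The squared length of the derivative of a scaled unit field. -/
lemma inner_smul_add_smul_self {F : Type*} [NormedAddCommGroup F] [InnerProductSpace ℝ F]
    {n y : F} (hn : ⟪n, n⟫ = 1) (hny : ⟪n, y⟫ = 0) (a b : ℝ) :
    ⟪a • n + b • y, a • n + b • y⟫ = a ^ 2 + b ^ 2 * ⟪y, y⟫ := by
  simp only [inner_add_left, inner_add_right, real_inner_smul_left, real_inner_smul_right, hn,
    hny, real_inner_comm n y]
  ring

/-- The normal components of the derivative of `∑ σ, γ σ • N σ` for an orthonormal
frame `N`. -/
lemma inner_sum_smul_add_smul {ι F : Type*} [Fintype ι] [DecidableEq ι] [NormedAddCommGroup F]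
    [InnerProductSpace ℝ F] {N N' : ι → F} {γ γ' : ι → ℝ}
    (hN : ∀ σ ω, ⟪N σ, N ω⟫ = if σ = ω then 1 else 0) (hN' : ∀ σ, ⟪N' σ, N σ⟫ = 0) (τ : ι) :
    ⟪∑ σ, (γ σ • N' σ + γ' σ • N σ), N τ⟫ =
      γ' τ + ∑ ω, γ ω * (if ω = τ then 0 else ⟪N' ω, N τ⟫) := by
  have h : ∀ ω, (if ω = τ then 0 else ⟪N' ω, N τ⟫) = ⟪N' ω, N τ⟫ := by
    intro ω
    split_ifs with h
    · rw [h, hN']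
    · rfl
  simp [sum_inner, inner_add_left, real_inner_smul_left, hN, h, Finset.sum_add_distrib, add_comm]

lemma fderiv_sum_smul_apply {ι E F : Type*} [Fintype ι] [NormedAddCommGroup E] [NormedSpace ℝ E]
    [NormedAddCommGroup F] [NormedSpace ℝ F] {N : ι → E → F} {γ : ι → E → ℝ} {p : E}
    (hγ : ∀ σ, DifferentiableAt ℝ (γ σ) p) (hN : ∀ σ, DifferentiableAt ℝ (N σ) p) (d : E) :
    fderiv ℝ (fun q => ∑ σ, γ σ q • N σ q) p d =
      ∑ σ, (γ σ p • fderiv ℝ (N σ) p d + fderiv ℝ (γ σ) p d • N σ p) := by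
  rw [fderiv_fun_sum fun σ _ => (hγ σ).fun_smul (hN σ)]
  simp [fderiv_fun_smul (hγ _) (hN _)]

lemma fderiv_Xvar_apply_s4 {d k : ℕ} {X : ℝ × ℝ → EuclideanSpace ℝ (Fin d)} {φ : ℝ × ℝ → ℝ}
    {γ : Fin k → ℝ × ℝ → ℝ} {N : Fin k → ℝ × ℝ → EuclideanSpace ℝ (Fin d)} {p : ℝ × ℝ}
    (hX : DifferentiableAt ℝ X p) (hφ : DifferentiableAt ℝ φ p)
    (hM : DifferentiableAt ℝ (fun q => ∑ σ, γ σ q • N σ q) p) (ε : ℝ) (v : ℝ × ℝ) :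
    fderiv ℝ (Xvar X φ γ N ε) p v = fderiv ℝ X p v + ε • (fderiv ℝ φ p v • ∑ σ, γ σ p • N σ p +
      φ p • fderiv ℝ (fun q => ∑ σ, γ σ q • N σ q) p v) := by
  have h : Xvar X φ γ N ε = fun q => X q + ε • (φ q • ∑ σ, γ σ q • N σ q) := by
    funext q
    rw [Xvar, mul_smul]
  rw [h, fderiv_fun_add hX ((hφ.fun_smul hM).fun_const_smul ε),
    fderiv_fun_const_smul (hφ.fun_smul hM), fderiv_fun_smul hφ hM]
  simp [add_comm]

/-- Second variation of the area element. -/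
theorem second_variation_area_element
    (m : ℕ)
    (X : ℝ × ℝ → EuclideanSpace ℝ (Fin (m + 3)))
    (hX : ContDiffOn ℝ 3 X Disc)
    (W : ℝ × ℝ → ℝ)
    (hWpos : ∀ p ∈ Disc, 0 < W p)
    (hconfu : ∀ p ∈ Disc, ⟪pdu X p, pdu X p⟫ = W p)
    (hconfv : ∀ p ∈ Disc, ⟪pdv X p, pdv X p⟫ = W p)
    (hconfuv : ∀ p ∈ Disc, ⟪pdu X p, pdv X p⟫ = 0)
    (N : Fin (m + 1) → ℝ × ℝ → EuclideanSpace ℝ (Fin (m + 3)))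
    (hN : ∀ σ, ContDiffOn ℝ 2 (N σ) Disc)
    (hNXu : ∀ σ, ∀ p ∈ Disc, ⟪pdu X p, N σ p⟫ = 0)
    (hNXv : ∀ σ, ∀ p ∈ Disc, ⟪pdv X p, N σ p⟫ = 0)
    (hNN : ∀ σ ω, ∀ p ∈ Disc, ⟪N σ p, N ω p⟫ = if σ = ω then 1 else 0)
    (γ : Fin (m + 1) → ℝ × ℝ → ℝ)
    (hγ : ∀ σ, ContDiffOn ℝ 2 (γ σ) Disc)
    (hγunit : ∀ p ∈ Disc, (∑ σ, (γ σ p) ^ 2) = 1)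
    (φ : ℝ × ℝ → ℝ)
    (hφ : ContDiff ℝ (⊤ : ℕ∞) φ)
    (hφsupp : tsupport φ ⊆ Metric.ball (0 : ℝ × ℝ) 1)
    : ∀ p ∈ Disc,
      iteratedDeriv 2 (fun ε : ℝ =>
          Real.sqrt (⟪pdu (Xvar X φ γ N ε) p, pdu (Xvar X φ γ N ε) p⟫ *
              ⟪pdv (Xvar X φ γ N ε) p, pdv (Xvar X φ γ N ε) p⟫ -
            ⟪pdu (Xvar X φ γ N ε) p, pdv (Xvar X φ γ N ε) p⟫ ^ 2)) 0
        = ((pdu φ p) ^ 2 + (pdv φ p) ^ 2)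
          + 2 * (((∑ σ, γ σ p * L11 X (N σ) p) * (∑ σ, γ σ p * L22 X (N σ) p) -
              (∑ σ, γ σ p * L12 X (N σ) p) ^ 2) / (W p) ^ 2) * W p * (φ p) ^ 2
          + (∑ σ, ((pdu (γ σ) p + ∑ ω, γ ω p * Tor1 N ω σ p) ^ 2 +
              (pdv (γ σ) p + ∑ ω, γ ω p * Tor2 N ω σ p) ^ 2)) * (φ p) ^ 2 := by
  intro p hp
  by_cases hball : p ∈ Metric.ball (0 : ℝ × ℝ) 1
  swap
  · have hφ0 : φ =ᶠ[nhds p] 0 := notMem_tsupport_iff_eventuallyEq.1 fun h => hball (hφsupp h)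
    have hvar : ∀ ε, fderiv ℝ (Xvar X φ γ N ε) p = fderiv ℝ X p := by
      intro ε
      refine Filter.EventuallyEq.fderiv_eq ?_
      filter_upwards [hφ0] with q hq
      simp [Xvar, hq]
    have hφ' : fderiv ℝ φ p = 0 := by
      rw [hφ0.fderiv_eq]
      simp
    simp [pdu, pdv, hvar, hφ', hφ0.self_of_nhds, iteratedDeriv_const]
  have hev : ∀ᶠ q in nhds p, q ∈ Disc :=
    Filter.mem_of_superset (Metric.isOpen_ball.mem_nhds hball) Metric.ball_subset_closedBall
  have hXp : ContDiffAt ℝ 3 X p := hX.contDiffAt hev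
  have hX2 : ContDiffAt ℝ 2 X p := hXp.of_le (by norm_num)
  have hXd : DifferentiableAt ℝ X p := hXp.differentiableAt (by norm_num)
  have hNd : ∀ σ, DifferentiableAt ℝ (N σ) p := fun σ =>
    ((hN σ).contDiffAt hev).differentiableAt (by norm_num)
  have hγd : ∀ σ, DifferentiableAt ℝ (γ σ) p := fun σ =>
    ((hγ σ).contDiffAt hev).differentiableAt (by norm_num)
  have hφd : DifferentiableAt ℝ φ p := hφ.contDiffAt.differentiableAt (by simp)
  have hXdd : ∀ d, DifferentiableAt ℝ (fun q => fderiv ℝ X q d) p := fun d =>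
    ((hX2.fderiv_right (m := 1) (by norm_num)).differentiableAt (by norm_num)).clm_apply
      (differentiableAt_const d)
  set M : ℝ × ℝ → EuclideanSpace ℝ (Fin (m + 3)) := fun q => ∑ σ, γ σ q • N σ q with hM
  have hMd : DifferentiableAt ℝ M p :=
    DifferentiableAt.fun_sum fun σ _ => (hγd σ).fun_smul (hNd σ)
  have hMM : ∀ q ∈ Disc, ⟪M q, M q⟫ = 1 := by
    intro q hq
    rw [← hγunit q hq]
    simp [hM, sum_inner, inner_sum, real_inner_smul_left, real_inner_smul_right, hNN _ _ q hq,
      -inner_self_eq_norm_sq_to_K, pow_two]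
  have hMder : ∀ d, ⟪M p, fderiv ℝ M p d⟫ = 0 := by
    intro d
    have h := inner_fderiv_add_inner_fderiv_eq_zero hMd hMd (hev.mono hMM) d
    rw [real_inner_comm] at h
    rw [real_inner_comm]
    linarith
  have hNder : ∀ d σ, ⟪fderiv ℝ (N σ) p d, N σ p⟫ = 0 := by
    intro d σ
    have h := inner_fderiv_add_inner_fderiv_eq_zero (hNd σ) (hNd σ) (hev.mono (hNN σ σ)) d
    rw [real_inner_comm] at h
    linarith
  have hMu : ∀ q ∈ Disc, ⟪fderiv ℝ X q (1, 0), M q⟫ = 0 := by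
    intro q hq
    have h : ∀ σ, ⟪fderiv ℝ X q (1, 0), N σ q⟫ = 0 := fun σ => hNXu σ q hq
    simp [hM, inner_sum, real_inner_smul_right, h]
  have hMv : ∀ q ∈ Disc, ⟪fderiv ℝ X q (0, 1), M q⟫ = 0 := by
    intro q hq
    have h : ∀ σ, ⟪fderiv ℝ X q (0, 1), N σ q⟫ = 0 := fun σ => hNXv σ q hq
    simp [hM, inner_sum, real_inner_smul_right, h]
  have hsff : ∀ d e, (∀ q ∈ Disc, ⟪fderiv ℝ X q e, M q⟫ = 0) → ⟪fderiv ℝ M p d, fderiv ℝ X p e⟫ =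
      -∑ σ, γ σ p * ⟪fderiv ℝ (fun q => fderiv ℝ X q e) p d, N σ p⟫ := by
    intro d e he
    have h := inner_fderiv_add_inner_fderiv_eq_zero (hXdd e) hMd (hev.mono he) d
    have h' : ⟪fderiv ℝ (fun q => fderiv ℝ X q e) p d, M p⟫ =
        ∑ σ, γ σ p * ⟪fderiv ℝ (fun q => fderiv ℝ X q e) p d, N σ p⟫ := by
      simp [hM, inner_sum, real_inner_smul_right]
    rw [← h', real_inner_comm]
    linarith
  have h11 : ⟪fderiv ℝ M p (1, 0), fderiv ℝ X p (1, 0)⟫ = -∑ σ, γ σ p * L11 X (N σ) p :=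
    hsff _ _ hMu
  have h21 : ⟪fderiv ℝ M p (0, 1), fderiv ℝ X p (1, 0)⟫ = -∑ σ, γ σ p * L12 X (N σ) p :=
    hsff _ _ hMu
  have h22 : ⟪fderiv ℝ M p (0, 1), fderiv ℝ X p (0, 1)⟫ = -∑ σ, γ σ p * L22 X (N σ) p :=
    hsff _ _ hMv
  have h12 : ⟪fderiv ℝ M p (1, 0), fderiv ℝ X p (0, 1)⟫ = -∑ σ, γ σ p * L12 X (N σ) p := by
    rw [hsff _ _ hMv, fderiv_fderiv_apply_comm hX2]
    rfl
  have hnormal : ∀ d σ, ⟪fderiv ℝ M p d, N σ p⟫ = fderiv ℝ (γ σ) p d +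
      ∑ ω, γ ω p * (if ω = σ then 0 else ⟪fderiv ℝ (N ω) p d, N σ p⟫) := by
    intro d σ
    rw [hM, fderiv_sum_smul_apply hγd hNd]
    exact inner_sum_smul_add_smul (fun σ ω => hNN σ ω p hp) (hNder d) σ
  have hw := hWpos p hp
  have hparseval : ∀ v : EuclideanSpace ℝ (Fin (m + 3)), ⟪v, v⟫ =
      (⟪v, fderiv ℝ X p (1, 0)⟫ ^ 2 + ⟪v, fderiv ℝ X p (0, 1)⟫ ^ 2) / W p +
        ∑ σ, ⟪v, N σ p⟫ ^ 2 := fun v =>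
    norm_sq_eq_of_conformal_frame hw (hconfu p hp) (hconfv p hp) (hconfuv p hp)
      (fun σ => hNXu σ p hp) (fun σ => hNXv σ p hp) (fun σ ω => hNN σ ω p hp)
  have hYu := inner_smul_add_smul_self (hMM p hp) (hMder (1, 0)) (fderiv ℝ φ p (1, 0)) (φ p)
  have hYv := inner_smul_add_smul_self (hMM p hp) (hMder (0, 1)) (fderiv ℝ φ p (0, 1)) (φ p)
  have hMXu : ⟪M p, fderiv ℝ X p (1, 0)⟫ = 0 := by rw [real_inner_comm, hMu p hp]
  have hMXv : ⟪M p, fderiv ℝ X p (0, 1)⟫ = 0 := by rw [real_inner_comm, hMv p hp]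
  have hYX : ∀ (a b : ℝ) (y e : EuclideanSpace ℝ (Fin (m + 3))), ⟪M p, e⟫ = 0 →
      ⟪a • M p + b • y, e⟫ = b * ⟪y, e⟫ := by
    intro a b y e h
    simp [inner_add_left, real_inner_smul_left, h]
  have hvar : ∀ ε d, fderiv ℝ (Xvar X φ γ N ε) p d =
      fderiv ℝ X p d + ε • (fderiv ℝ φ p d • M p + φ p • fderiv ℝ M p d) :=
    fderiv_Xvar_apply_s4 hXd hφd hMd
  have hconf := iteratedDeriv_two_sqrt_gram_add_smul hw (hconfu p hp) (hconfv p hp) (hconfuv p hp)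
  simp only [pdu, pdv] at hconf
  simp only [pdu, pdv, hvar]
  rw [hconf, hYu, hYv,
    hYX _ _ _ _ hMXu, hYX _ _ _ _ hMXu, hYX _ _ _ _ hMXv, hYX _ _ _ _ hMXv,
    hparseval (fderiv ℝ M p (1, 0)), hparseval (fderiv ℝ M p (0, 1)), h11, h12, h21, h22]
  simp only [hnormal, Tor1, Tor2, pdu, pdv, Finset.sum_add_distrib]
  field_simp
  ring
end
end

section
/- µ-stability of stable minimal surfaces with flat normal bundle: let X be minimal (H_σ ≡ 0 for all σ) with a torsion-free orthonormal normal section (T_{σ,i}^ω ≡ 0 for all σ,ω,i), and suppose that for each ϑ ∈ {1,…,n−2} and all φ ∈ C₀^∞(B,ℝ) the second variation of area in the direction N_ϑ is nonnegative, i.e. ∬_B (|∇φ|² + 2K_ϑ W φ²) du dv ≥ 0. Then X is µ-stable with q ≡ 0 for every µ with 0 < µ ≤ 2/(n−2): ∬_B |∇φ|² du dv ≥ µ ∬_B (−K) W φ² du dv for all φ ∈ C₀^∞(B,ℝ). -/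
open scoped RealInnerProductSpace BigOperators
open MeasureTheory

noncomputable section

theorem ContDiffOn.pdu_of_isOpen {F : Type*} [NormedAddCommGroup F] [NormedSpace ℝ F]
    {f : ℝ × ℝ → F} {s : Set (ℝ × ℝ)} {k n : WithTop ℕ∞} (hf : ContDiffOn ℝ n f s)
    (hs : IsOpen s) (hkn : k + 1 ≤ n) : ContDiffOn ℝ k (pdu f) s :=
  (hf.fderiv_of_isOpen hs hkn).clm_apply contDiffOn_const

theorem ContDiffOn.pdv_of_isOpen {F : Type*} [NormedAddCommGroup F] [NormedSpace ℝ F]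
    {f : ℝ × ℝ → F} {s : Set (ℝ × ℝ)} {k n : WithTop ℕ∞} (hf : ContDiffOn ℝ n f s)
    (hs : IsOpen s) (hkn : k + 1 ≤ n) : ContDiffOn ℝ k (pdv f) s :=
  (hf.fderiv_of_isOpen hs hkn).clm_apply contDiffOn_const

/-- A weight continuous on an open set, multiplied by the square of a continuous function supported
there, is continuous everywhere. -/
theorem ContinuousOn.continuous_mul_sq {E : Type*} [TopologicalSpace E] {g φ : E → ℝ} {s : Set E}
    (hg : ContinuousOn g s) (hs : IsOpen s) (hφ : Continuous φ) (hsupp : tsupport φ ⊆ s) :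
    Continuous fun p => g p * φ p ^ 2 := by
  refine (hg.mul (hφ.pow 2).continuousOn).continuous_of_tsupport_subset hs
    ((closure_mono ?_).trans hsupp)
  intro p hp hφp
  exact hp (by simp [hφp])

/-- Summing weighted Poincaré inequalities with nonnegative weights `-κ i` over a finite index
type. -/
theorem MeasureTheory.mul_integral_neg_sum_le {α ι : Type*} [MeasurableSpace α] [Fintype ι]
    [Nonempty ι] {ν : Measure α} {G : α → ℝ} {κ : ι → α → ℝ} (hG : Integrable G ν)
    (hκ : ∀ i, Integrable (κ i) ν) (hκ0 : ∀ i, ∫ p, κ i p ∂ν ≤ 0)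
    (hstab : ∀ i, 0 ≤ ∫ p, (G p + 2 * κ i p) ∂ν) {μ : ℝ} (hμ : μ ≤ 2 / Fintype.card ι) :
    μ * ∫ p, -∑ i, κ i p ∂ν ≤ ∫ p, G p ∂ν := by
  have hcard : (0 : ℝ) < Fintype.card ι := by exact_mod_cast Fintype.card_pos
  have hsum : ∑ i, 2 * -(∫ p, κ i p ∂ν) ≤ Fintype.card ι * ∫ p, G p ∂ν := by
    rw [← nsmul_eq_mul, ← Finset.card_univ, ← Finset.sum_const]
    refine Finset.sum_le_sum fun i _ => ?_
    have h := hstab i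
    rw [integral_add hG ((hκ i).const_mul 2), integral_const_mul] at h
    linarith
  rw [← Finset.mul_sum, Finset.sum_neg_distrib] at hsum
  rw [integral_neg, integral_finsetSum _ fun i _ => hκ i]
  have hnonneg : 0 ≤ -∑ i, ∫ p, κ i p ∂ν :=
    neg_nonneg.mpr (Finset.sum_nonpos fun i _ => hκ0 i)
  calc μ * -∑ i, ∫ p, κ i p ∂ν
      ≤ 2 / Fintype.card ι * -∑ i, ∫ p, κ i p ∂ν := mul_le_mul_of_nonneg_right hμ hnonneg
    _ ≤ ∫ p, G p ∂ν := by
      rw [div_mul_eq_mul_div, div_le_iff₀ hcard]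
      linarith

/-- µ-stability of stable minimal surfaces with flat normal bundle. -/
theorem mu_stability_minimal_flat_normal_bundle
    (m : ℕ)
    (X : ℝ × ℝ → EuclideanSpace ℝ (Fin (m + 3)))
    (hX : ContDiffOn ℝ 3 X Disc)
    (W : ℝ × ℝ → ℝ)
    (hWpos : ∀ p ∈ Disc, 0 < W p)
    (hconfu : ∀ p ∈ Disc, ⟪pdu X p, pdu X p⟫ = W p)
    (hconfv : ∀ p ∈ Disc, ⟪pdv X p, pdv X p⟫ = W p)
    (hconfuv : ∀ p ∈ Disc, ⟪pdu X p, pdv X p⟫ = 0)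
    (N : Fin (m + 1) → ℝ × ℝ → EuclideanSpace ℝ (Fin (m + 3)))
    (hN : ∀ σ, ContDiffOn ℝ 2 (N σ) Disc)
    (hNXu : ∀ σ, ∀ p ∈ Disc, ⟪pdu X p, N σ p⟫ = 0)
    (hNXv : ∀ σ, ∀ p ∈ Disc, ⟪pdv X p, N σ p⟫ = 0)
    (hNN : ∀ σ ω, ∀ p ∈ Disc, ⟪N σ p, N ω p⟫ = if σ = ω then 1 else 0)
    -- X is minimal: `H_σ ≡ 0` for all `σ`
    (hminimal : ∀ σ, ∀ p ∈ Disc, (L11 X (N σ) p + L22 X (N σ) p) / (2 * W p) = 0)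
    -- the orthonormal normal section is torsion-free
    (htorsionfree : ∀ σ ω, ∀ p ∈ Disc, Tor1 N σ ω p = 0 ∧ Tor2 N σ ω p = 0)
    -- stability of the second variation of area in each normal direction `N_ϑ`
    (hstab : ∀ ϑ, ∀ φ : ℝ × ℝ → ℝ, ContDiff ℝ (⊤ : ℕ∞) φ →
      tsupport φ ⊆ Metric.ball (0 : ℝ × ℝ) 1 →
      0 ≤ ∫ p in Disc,
            ((pdu φ p) ^ 2 + (pdv φ p) ^ 2 +
              2 * ((L11 X (N ϑ) p * L22 X (N ϑ) p - (L12 X (N ϑ) p) ^ 2) / (W p) ^ 2) *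
                W p * (φ p) ^ 2))
    : ∀ μ : ℝ, 0 < μ → μ ≤ 2 / ((m : ℝ) + 1) →
      ∀ φ : ℝ × ℝ → ℝ, ContDiff ℝ (⊤ : ℕ∞) φ →
        tsupport φ ⊆ Metric.ball (0 : ℝ × ℝ) 1 →
        μ * ∫ p in Disc,
            (-(∑ σ, (L11 X (N σ) p * L22 X (N σ) p - (L12 X (N σ) p) ^ 2) / (W p) ^ 2)) *
              W p * (φ p) ^ 2
          ≤ ∫ p in Disc, ((pdu φ p) ^ 2 + (pdv φ p) ^ 2) := by
  intro μ _ hμ φ hφ hsupp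
  have hball : IsOpen (Metric.ball (0 : ℝ × ℝ) 1) := Metric.isOpen_ball
  have hsub : Metric.ball (0 : ℝ × ℝ) 1 ⊆ Disc := Metric.ball_subset_closedBall
  have hcompact : IsCompact Disc := isCompact_closedBall 0 1
  have hXu : ContDiffOn ℝ 2 (pdu X) (Metric.ball 0 1) :=
    (hX.mono hsub).pdu_of_isOpen hball (by norm_num)
  have hXv : ContDiffOn ℝ 2 (pdv X) (Metric.ball 0 1) :=
    (hX.mono hsub).pdv_of_isOpen hball (by norm_num)
  have hW : ContinuousOn W (Metric.ball 0 1) :=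
    (hXu.continuousOn.inner hXu.continuousOn).congr fun p hp => (hconfu p (hsub hp)).symm
  have hNc : ∀ σ, ContinuousOn (N σ) (Metric.ball 0 1) := fun σ => (hN σ).continuousOn.mono hsub
  have hL11 : ∀ σ, ContinuousOn (L11 X (N σ)) (Metric.ball 0 1) := fun σ =>
    (hXu.pdu_of_isOpen (k := 1) hball (by norm_num)).continuousOn.inner (hNc σ)
  have hL12 : ∀ σ, ContinuousOn (L12 X (N σ)) (Metric.ball 0 1) := fun σ =>
    (hXu.pdv_of_isOpen (k := 1) hball (by norm_num)).continuousOn.inner (hNc σ)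
  have hL22 : ∀ σ, ContinuousOn (L22 X (N σ)) (Metric.ball 0 1) := fun σ =>
    (hXv.pdv_of_isOpen (k := 1) hball (by norm_num)).continuousOn.inner (hNc σ)
  have hG : IntegrableOn (fun p => pdu φ p ^ 2 + pdv φ p ^ 2) Disc := by
    have hφ' : Continuous (fderiv ℝ φ) := hφ.continuous_fderiv (by simp)
    exact (((hφ'.clm_apply continuous_const).pow 2).add
      ((hφ'.clm_apply continuous_const).pow 2)).continuousOn.integrableOn_compact hcompact
  have hκ : ∀ σ, IntegrableOn (fun p => (L11 X (N σ) p * L22 X (N σ) p - L12 X (N σ) p ^ 2) /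
      W p ^ 2 * W p * φ p ^ 2) Disc := fun σ => by
    refine (ContinuousOn.continuous_mul_sq ?_ hball hφ.continuous
      hsupp).continuousOn.integrableOn_compact hcompact
    exact (((((hL11 σ).mul (hL22 σ)).sub ((hL12 σ).pow 2)).div (hW.pow 2)
      fun p hp => pow_ne_zero 2 (hWpos p (hsub hp)).ne').mul hW)
  have hκ0 : ∀ σ, ∫ p in Disc, (L11 X (N σ) p * L22 X (N σ) p - L12 X (N σ) p ^ 2) /
      W p ^ 2 * W p * φ p ^ 2 ≤ 0 := fun σ => by
    refine setIntegral_nonpos hcompact.measurableSet fun p hp => ?_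
    have hWp := hWpos p hp
    have htrace : L22 X (N σ) p = -L11 X (N σ) p := by
      have h := hminimal σ p hp
      rw [div_eq_zero_iff] at h
      rcases h with h | h <;> linarith
    refine mul_nonpos_of_nonpos_of_nonneg (mul_nonpos_of_nonpos_of_nonneg
      (div_nonpos_of_nonpos_of_nonneg ?_ (by positivity)) hWp.le) (by positivity)
    rw [htrace]
    nlinarith [sq_nonneg (L11 X (N σ) p), sq_nonneg (L12 X (N σ) p)]
  have hmain := mul_integral_neg_sum_le hG hκ hκ0
    (fun σ => by simpa only [mul_assoc] using hstab σ φ hφ hsupp) (μ := μ) (by simpa using hμ)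
  simpa only [Finset.sum_mul, neg_mul] using hmain
end
end

section
/- Isolated zeros of the Gaussian curvature: let X be minimal (H_σ ≡ 0 for all σ) with a torsion-free orthonormal normal section (T_{σ,i}^ω ≡ 0), and suppose the Gaussian curvature K := Σ_σ K_σ does not vanish identically on B. Then in every compact subset B' of the open unit disc, K vanishes at most at isolated points; equivalently, the zero set of K has no accumulation point in the open disc. -/
open scoped RealInnerProductSpace BigOperators
open MeasureTheory

noncomputable section

section PartialDerivatives

variable {F : Type*} [NormedAddCommGroup F] [NormedSpace ℝ F]

theorem ContDiffOn.pdu {n k : WithTop ℕ∞} {f : ℝ × ℝ → F} {U : Set (ℝ × ℝ)}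
    (hf : ContDiffOn ℝ n f U) (hU : IsOpen U) (hk : k + 1 ≤ n) : ContDiffOn ℝ k (pdu f) U :=
  (hf.fderiv_of_isOpen hU hk).clm_apply contDiffOn_const

theorem ContDiffOn.pdv {n k : WithTop ℕ∞} {f : ℝ × ℝ → F} {U : Set (ℝ × ℝ)}
    (hf : ContDiffOn ℝ n f U) (hU : IsOpen U) (hk : k + 1 ≤ n) : ContDiffOn ℝ k (pdv f) U :=
  (hf.fderiv_of_isOpen hU hk).clm_apply contDiffOn_const

theorem pdv_pdu_comm {f : ℝ × ℝ → F} {U : Set (ℝ × ℝ)} (hf : ContDiffOn ℝ 2 f U)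
    (hU : IsOpen U) {p : ℝ × ℝ} (hp : p ∈ U) : pdv (pdu f) p = pdu (pdv f) p := by
  have hf' : ContDiffAt ℝ 2 f p := hf.contDiffAt (hU.mem_nhds hp)
  have hd : DifferentiableAt ℝ (fderiv ℝ f) p :=
    (hf'.fderiv_right (m := 1) (by norm_num)).differentiableAt one_ne_zero
  have key (v w : ℝ × ℝ) : fderiv ℝ (fun q => fderiv ℝ f q v) p w
      = fderiv ℝ (fderiv ℝ f) p w v := by
    rw [fderiv_clm_apply hd (differentiableAt_const v)]
    simp
  exact (key _ _).trans (((hf'.isSymmSndFDerivAt (by simp)) _ _).trans (key _ _).symm)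

theorem pdu_congr {f g : ℝ × ℝ → F} {U : Set (ℝ × ℝ)} (hU : IsOpen U) (h : Set.EqOn f g U)
    {p : ℝ × ℝ} (hp : p ∈ U) : pdu f p = pdu g p := by
  simp only [pdu, (h.eventuallyEq_of_mem (hU.mem_nhds hp)).fderiv_eq]

theorem pdv_congr {f g : ℝ × ℝ → F} {U : Set (ℝ × ℝ)} (hU : IsOpen U) (h : Set.EqOn f g U)
    {p : ℝ × ℝ} (hp : p ∈ U) : pdv f p = pdv g p := by
  simp only [pdv, (h.eventuallyEq_of_mem (hU.mem_nhds hp)).fderiv_eq]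

theorem pdu_zero (p : ℝ × ℝ) : pdu (fun _ => (0 : F)) p = 0 := by
  simp [pdu]

theorem pdv_zero (p : ℝ × ℝ) : pdv (fun _ => (0 : F)) p = 0 := by
  simp [pdv]

variable {E : Type*} [NormedAddCommGroup E] [InnerProductSpace ℝ E]

theorem pdu_inner {f g : ℝ × ℝ → E} {p : ℝ × ℝ} (hf : DifferentiableAt ℝ f p)
    (hg : DifferentiableAt ℝ g p) :
    pdu (fun q => ⟪f q, g q⟫) p = ⟪f p, pdu g p⟫ + ⟪pdu f p, g p⟫ :=
  fderiv_inner_apply ℝ hf hg _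

theorem pdv_inner {f g : ℝ × ℝ → E} {p : ℝ × ℝ} (hf : DifferentiableAt ℝ f p)
    (hg : DifferentiableAt ℝ g p) :
    pdv (fun q => ⟪f q, g q⟫) p = ⟪f p, pdv g p⟫ + ⟪pdv f p, g p⟫ :=
  fderiv_inner_apply ℝ hf hg _

end PartialDerivatives

section CauchyRiemann

theorem differentiableAt_complex_of_cauchyRiemann {a b : ℝ × ℝ → ℝ} {z : ℂ}
    (ha : DifferentiableAt ℝ a (z.re, z.im)) (hb : DifferentiableAt ℝ b (z.re, z.im))
    (hu : pdu a (z.re, z.im) = pdv b (z.re, z.im))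
    (hv : pdv a (z.re, z.im) = -pdu b (z.re, z.im)) :
    DifferentiableAt ℂ
      (fun w : ℂ => (a (w.re, w.im) : ℂ) + (b (w.re, w.im) : ℂ) * Complex.I) z := by
  have hz : HasFDerivAt (fun w : ℂ => (w.re, w.im))
      (Complex.reCLM.prod Complex.imCLM) z :=
    (Complex.reCLM.prod Complex.imCLM).hasFDerivAt
  have ha' := (Complex.ofRealCLM.hasFDerivAt.comp z
    (HasFDerivAt.comp z (f := fun w : ℂ => (w.re, w.im)) ha.hasFDerivAt hz))
  have hb' := (Complex.ofRealCLM.hasFDerivAt.comp z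
    (HasFDerivAt.comp z (f := fun w : ℂ => (w.re, w.im)) hb.hasFDerivAt hz))
  have h := ha'.add (hb'.mul_const Complex.I)
  simp only [pdu, pdv] at hu hv
  refine (h.complexOfReal_hasFDerivAt ?_).differentiableAt
  simp [hu, hv]
  linear_combination (-(fderiv ℝ b (z.re, z.im) (1, 0) : ℂ)) * Complex.I_mul_I

theorem eqOn_zero_of_cauchyRiemann_of_frequently_eq_zero {a b : ℝ × ℝ → ℝ} {U : Set (ℝ × ℝ)}
    (hU : IsOpen U) (hUc : IsPreconnected U)
    (ha : DifferentiableOn ℝ a U) (hb : DifferentiableOn ℝ b U)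
    (hu : ∀ p ∈ U, pdu a p = pdv b p) (hv : ∀ p ∈ U, pdv a p = -pdu b p)
    {z : ℝ × ℝ} (hz : z ∈ U) (hfreq : ∃ᶠ q in nhdsWithin z {z}ᶜ, a q = 0 ∧ b q = 0) :
    ∀ q ∈ U, a q = 0 ∧ b q = 0 := by
  let e : ℂ ≃ₜ ℝ × ℝ := Complex.equivRealProdCLM.toHomeomorph
  let f : ℂ → ℂ := fun w => (a (e w) : ℂ) + (b (e w) : ℂ) * Complex.I
  have hf0 (w : ℂ) : f w = 0 ↔ a (e w) = 0 ∧ b (e w) = 0 := by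
    rw [Complex.ext_iff]
    simp [f]
  have hf : AnalyticOnNhd ℂ f (e ⁻¹' U) := by
    refine DifferentiableOn.analyticOnNhd (fun w hw => ?_) (hU.preimage e.continuous)
    have hw' : U ∈ nhds (w.re, w.im) := hU.mem_nhds hw
    exact (differentiableAt_complex_of_cauchyRiemann (ha.differentiableAt hw')
      (hb.differentiableAt hw') (hu _ hw) (hv _ hw)).differentiableWithinAt
  have hfreq' : ∃ᶠ w in nhdsWithin (e.symm z) {e.symm z}ᶜ, f w = 0 := by
    have ht : Filter.Tendsto e.symm (nhdsWithin z {z}ᶜ)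
        (nhdsWithin (e.symm z) {e.symm z}ᶜ) :=
      e.symm.continuous.continuousWithinAt.tendsto_nhdsWithin
        fun q hq => fun h => hq (e.symm.injective h)
    refine ht.frequently (hfreq.mono fun q hq => ?_)
    rw [hf0]
    simpa using hq
  have hzero := hf.eqOn_zero_of_preconnected_of_frequently_eq_zero
    (e.isPreconnected_preimage.mpr hUc) (z₀ := e.symm z) (by simpa using hz) hfreq'
  intro q hq
  have := (hf0 (e.symm q)).mp (hzero (by simpa using hq))
  simpa using this

end CauchyRiemann

/-- A vector orthogonal to a normal frame is determined by its tangential components with respect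
to a conformal tangent frame. -/
theorem mul_inner_eq_of_orthogonal_normal_frame {m : ℕ} {a b : EuclideanSpace ℝ (Fin (m + 3))}
    {n : Fin (m + 1) → EuclideanSpace ℝ (Fin (m + 3))} {w : ℝ} (hw : 0 < w)
    (haa : ⟪a, a⟫ = w) (hbb : ⟪b, b⟫ = w) (hab : ⟪a, b⟫ = 0)
    (han : ∀ σ, ⟪a, n σ⟫ = 0) (hbn : ∀ σ, ⟪b, n σ⟫ = 0)
    (hnn : ∀ σ ω, ⟪n σ, n ω⟫ = if σ = ω then 1 else 0)
    (x : EuclideanSpace ℝ (Fin (m + 3))) {y : EuclideanSpace ℝ (Fin (m + 3))}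
    (hy : ∀ σ, ⟪y, n σ⟫ = 0) :
    w * ⟪x, y⟫ = ⟪x, a⟫ * ⟪a, y⟫ + ⟪x, b⟫ * ⟪b, y⟫ := by
  let v : Option (Option (Fin (m + 1))) → EuclideanSpace ℝ (Fin (m + 3))
    | none => a
    | some none => b
    | some (some σ) => n σ
  have hba : ⟪b, a⟫ = 0 := by rw [real_inner_comm, hab]
  have hli : LinearIndependent ℝ v := by
    refine linearIndependent_of_ne_zero_of_inner_eq_zero (𝕜 := ℝ) ?_ ?_
    · rintro (_ | _ | σ) h <;> simp only [v] at h
      · simp [h] at haa; linarith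
      · simp [h] at hbb; linarith
      · simpa [h] using hnn σ σ
    · rintro (_ | _ | σ) (_ | _ | ω) h <;> simp only [v]
      · exact absurd rfl h
      · exact hab
      · exact han ω
      · exact hba
      · exact absurd rfl h
      · exact hbn ω
      · rw [real_inner_comm]; exact han σ
      · rw [real_inner_comm]; exact hbn σ
      · rw [hnn, if_neg]
        rintro rfl
        exact h rfl
  have hspan : Submodule.span ℝ (Set.range v) = ⊤ :=
    hli.span_eq_top_of_card_eq_finrank' (by simp)
  have hz : w • y - ⟪a, y⟫ • a - ⟪b, y⟫ • b = 0 := by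
    refine InnerProductSpace.ext_inner_left_basis (𝕜 := ℝ)
      (Module.Basis.mk hli hspan.ge) fun i => ?_
    have hny (σ) : ⟪n σ, y⟫ = 0 := by rw [real_inner_comm, hy]
    have hna (σ) : ⟪n σ, a⟫ = 0 := by rw [real_inner_comm, han]
    have hnb (σ) : ⟪n σ, b⟫ = 0 := by rw [real_inner_comm, hbn]
    rcases i with _ | _ | σ <;>
      simp only [Module.Basis.mk_apply, v, inner_sub_right, inner_smul_right, inner_zero_right,
        haa, hbb, hab, hba, hny, hna, hnb] <;> ring
  have h := congrArg (fun t => ⟪x, t⟫) hz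
  simp only [inner_sub_right, inner_smul_right, inner_zero_right] at h
  linarith

/-- The Codazzi equations of a minimal conformal immersion with torsion-free normal frame. -/
theorem codazzi_of_minimal_torsionfree {m : ℕ} {U : Set (ℝ × ℝ)} (hU : IsOpen U)
    {X : ℝ × ℝ → EuclideanSpace ℝ (Fin (m + 3))} (hX : ContDiffOn ℝ 3 X U)
    {W : ℝ × ℝ → ℝ} (hWpos : ∀ p ∈ U, 0 < W p)
    (hconfu : ∀ p ∈ U, ⟪pdu X p, pdu X p⟫ = W p)
    (hconfv : ∀ p ∈ U, ⟪pdv X p, pdv X p⟫ = W p)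
    (hconfuv : ∀ p ∈ U, ⟪pdu X p, pdv X p⟫ = 0)
    {N : Fin (m + 1) → ℝ × ℝ → EuclideanSpace ℝ (Fin (m + 3))}
    (hN : ∀ σ, DifferentiableOn ℝ (N σ) U)
    (hNXu : ∀ σ, ∀ p ∈ U, ⟪pdu X p, N σ p⟫ = 0)
    (hNXv : ∀ σ, ∀ p ∈ U, ⟪pdv X p, N σ p⟫ = 0)
    (hNN : ∀ σ ω, ∀ p ∈ U, ⟪N σ p, N ω p⟫ = if σ = ω then 1 else 0)
    (hminimal : ∀ σ, ∀ p ∈ U, L11 X (N σ) p + L22 X (N σ) p = 0)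
    (htorsionfree : ∀ σ ω, ∀ p ∈ U, Tor1 N σ ω p = 0 ∧ Tor2 N σ ω p = 0)
    (σ : Fin (m + 1)) {p : ℝ × ℝ} (hp : p ∈ U) :
    pdv (L11 X (N σ)) p = pdu (L12 X (N σ)) p ∧ pdv (L12 X (N σ)) p = pdu (L22 X (N σ)) p := by
  have hUp : U ∈ nhds p := hU.mem_nhds hp
  have hXu : ContDiffOn ℝ 2 (pdu X) U := hX.pdu hU (by norm_num)
  have hXv : ContDiffOn ℝ 2 (pdv X) U := hX.pdv hU (by norm_num)
  have dXu : DifferentiableAt ℝ (pdu X) p := (hXu.contDiffAt hUp).differentiableAt two_ne_zero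
  have dXv : DifferentiableAt ℝ (pdv X) p := (hXv.contDiffAt hUp).differentiableAt two_ne_zero
  have dXuu : DifferentiableAt ℝ (pdu (pdu X)) p :=
    ((hXu.pdu hU (k := 1) (by norm_num)).contDiffAt hUp).differentiableAt one_ne_zero
  have dXuv : DifferentiableAt ℝ (pdv (pdu X)) p :=
    ((hXu.pdv hU (k := 1) (by norm_num)).contDiffAt hUp).differentiableAt one_ne_zero
  have dXvv : DifferentiableAt ℝ (pdv (pdv X)) p :=
    ((hXv.pdv hU (k := 1) (by norm_num)).contDiffAt hUp).differentiableAt one_ne_zero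
  have dN (ω) : DifferentiableAt ℝ (N ω) p := (hN ω).differentiableAt hUp
  have hcomm : ∀ q ∈ U, pdv (pdu X) q = pdu (pdv X) q := fun q hq =>
    pdv_pdu_comm (hX.of_le (by norm_num)) hU hq
  have hXuuv : pdv (pdu (pdu X)) p = pdu (pdv (pdu X)) p := pdv_pdu_comm hXu hU hp
  have hXuvv : pdv (pdv (pdu X)) p = pdu (pdv (pdv X)) p :=
    (pdv_congr hU hcomm hp).trans (pdv_pdu_comm hXv hU hp)
  have tang : ∀ ω, ⟪pdu (N σ) p, N ω p⟫ = 0 ∧ ⟪pdv (N σ) p, N ω p⟫ = 0 := by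
    intro ω
    rcases eq_or_ne σ ω with rfl | hne
    · have hc : Set.EqOn (fun q => ⟪N σ q, N σ q⟫) (fun _ => (1 : ℝ)) U := fun q hq =>
        (hNN σ σ q hq).trans (if_pos rfl)
      have h1 := pdu_congr hU hc hp
      have h2 := pdv_congr hU hc hp
      rw [pdu_inner (dN σ) (dN σ), real_inner_comm] at h1
      rw [pdv_inner (dN σ) (dN σ), real_inner_comm] at h2
      simp only [pdu, pdv, fderiv_fun_const, Pi.zero_apply, zero_apply] at h1 h2 ⊢
      constructor <;> linarith
    · simpa [Tor1, Tor2, hne] using htorsionfree σ ω p hp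
  have frame (x : EuclideanSpace ℝ (Fin (m + 3))) {y : EuclideanSpace ℝ (Fin (m + 3))}
      (hy : ∀ ω, ⟪y, N ω p⟫ = 0) :=
    mul_inner_eq_of_orthogonal_normal_frame (hWpos p hp) (hconfu p hp) (hconfv p hp)
      (hconfuv p hp) (fun ω => hNXu ω p hp) (fun ω => hNXv ω p hp)
      (fun ω τ => hNN ω τ p hp) x hy
  have hW : W p ≠ 0 := (hWpos p hp).ne'
  have hmin := hminimal σ p hp
  -- Weingarten equations
  have w11 := (pdu_congr hU (g := fun _ => (0 : ℝ)) (hNXu σ) hp).trans (pdu_zero p)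
  have w12 := (pdv_congr hU (g := fun _ => (0 : ℝ)) (hNXu σ) hp).trans (pdv_zero p)
  have w21 := (pdu_congr hU (g := fun _ => (0 : ℝ)) (hNXv σ) hp).trans (pdu_zero p)
  have w22 := (pdv_congr hU (g := fun _ => (0 : ℝ)) (hNXv σ) hp).trans (pdv_zero p)
  rw [pdu_inner dXu (dN σ)] at w11
  rw [pdv_inner dXu (dN σ)] at w12
  rw [pdu_inner dXv (dN σ), ← hcomm p hp] at w21
  rw [pdv_inner dXv (dN σ)] at w22
  -- derivatives of the conformality relations
  have hconf : Set.EqOn (fun q => ⟪pdu X q, pdu X q⟫) (fun q => ⟪pdv X q, pdv X q⟫) U :=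
    fun q hq => (hconfu q hq).trans (hconfv q hq).symm
  have cu := pdu_congr hU hconf hp
  have cv := pdv_congr hU hconf hp
  have ou := (pdu_congr hU (g := fun _ => (0 : ℝ)) hconfuv hp).trans (pdu_zero p)
  have ov := (pdv_congr hU (g := fun _ => (0 : ℝ)) hconfuv hp).trans (pdv_zero p)
  rw [pdu_inner dXu dXu, pdu_inner dXv dXv, real_inner_comm (pdu (pdu X) p) (pdu X p),
    real_inner_comm (pdu (pdv X) p) (pdv X p), ← hcomm p hp] at cu
  rw [pdv_inner dXu dXu, pdv_inner dXv dXv, real_inner_comm (pdv (pdu X) p) (pdu X p),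
    real_inner_comm (pdv (pdv X) p) (pdv X p)] at cv
  rw [pdu_inner dXu dXv, ← hcomm p hp, real_inner_comm (pdv (pdu X) p) (pdu X p)] at ou
  rw [pdv_inner dXu dXv, real_inner_comm (pdv (pdv X) p) (pdu X p)] at ov
  have e1 := frame (pdu (pdu X) p) (fun ω => (tang ω).2)
  have e2 := frame (pdv (pdu X) p) (fun ω => (tang ω).1)
  have e3 := frame (pdv (pdu X) p) (fun ω => (tang ω).2)
  have e4 := frame (pdv (pdv X) p) (fun ω => (tang ω).1)
  have d1 : pdv (L11 X (N σ)) p = _ := pdv_inner dXuu (dN σ)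
  have d2 : pdu (L12 X (N σ)) p = _ := pdu_inner dXuv (dN σ)
  have d3 : pdv (L12 X (N σ)) p = _ := pdv_inner dXuv (dN σ)
  have d4 : pdu (L22 X (N σ)) p = _ := pdu_inner dXvv (dN σ)
  rw [d1, d2, d3, d4, hXuuv, hXuvv]
  simp only [L11, L22] at hmin
  rw [eq_neg_of_add_eq_zero_left w11, eq_neg_of_add_eq_zero_left w21] at e2 e4
  rw [eq_neg_of_add_eq_zero_left w12, eq_neg_of_add_eq_zero_left w22] at e1 e3
  constructor <;> congr 1 <;> apply mul_left_cancel₀ hW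
  · rw [e1, e2]
    linear_combination ⟪pdv (pdu X) p, pdu X p⟫ * hmin
      - ⟪pdv (pdv X) p, N σ p⟫ * ou - ⟪pdv (pdu X) p, N σ p⟫ * cu / 2
  · rw [e3, e4]
    linear_combination -⟪pdv (pdu X) p, pdv X p⟫ * hmin
      + ⟪pdu (pdu X) p, N σ p⟫ * ov - ⟪pdv (pdu X) p, N σ p⟫ * cv / 2

/-- If `fderiv ℝ g · v` is orthogonal to a continuous field in the interior of a convex body, then
so it is on the boundary, where `fderiv` is either the one-sided derivative or zero. -/
theorem inner_fderiv_eq_zero_of_interior {V F : Type*} [NormedAddCommGroup V] [NormedSpace ℝ V]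
    [NormedAddCommGroup F] [InnerProductSpace ℝ F] {S : Set V} (hS : Convex ℝ S)
    (hS' : (interior S).Nonempty) {g n : V → F} (hg : ContDiffOn ℝ 1 g S)
    (hn : ContinuousOn n S) {v : V} (h : ∀ q ∈ interior S, ⟪fderiv ℝ g q v, n q⟫ = 0)
    {p : V} (hp : p ∈ S) : ⟪fderiv ℝ g p v, n p⟫ = 0 := by
  have hU := uniqueDiffOn_convex hS hS'
  by_cases hd : DifferentiableAt ℝ g p
  · have hc : ContinuousOn (fun q => ⟪fderivWithin ℝ g S q v, n q⟫) S :=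
      ((hg.continuousOn_fderivWithin hU le_rfl).clm_apply continuousOn_const).inner hn
    have h0 : Set.EqOn (fun q => ⟪fderivWithin ℝ g S q v, n q⟫) (fun _ => (0 : ℝ))
        (interior S) := fun q hq => by
      simp only [fderivWithin_of_mem_nhds (mem_interior_iff_mem_nhds.mp hq), h q hq]
    have hcl : S ⊆ closure (interior S) :=
      (hS.closure_interior_eq_closure_of_nonempty_interior hS').symm ▸ subset_closure
    have := h0.of_subset_closure hc continuousOn_const interior_subset hcl hp
    simpa only [hd.fderivWithin (hU p hp)] using this
  · simp [fderiv_zero_of_not_differentiableAt hd]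

/-- Isolated zeros of the Gaussian curvature of a minimal surface with flat normal bundle: the zero set of K has no accumulation point in the open unit disc. -/
theorem gaussian_curvature_isolated_zeros
    (m : ℕ)
    (X : ℝ × ℝ → EuclideanSpace ℝ (Fin (m + 3)))
    (hX : ContDiffOn ℝ 3 X Disc)
    (W : ℝ × ℝ → ℝ)
    (hWpos : ∀ p ∈ Disc, 0 < W p)
    (hconfu : ∀ p ∈ Disc, ⟪pdu X p, pdu X p⟫ = W p)
    (hconfv : ∀ p ∈ Disc, ⟪pdv X p, pdv X p⟫ = W p)
    (hconfuv : ∀ p ∈ Disc, ⟪pdu X p, pdv X p⟫ = 0)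
    (N : Fin (m + 1) → ℝ × ℝ → EuclideanSpace ℝ (Fin (m + 3)))
    (hN : ∀ σ, ContDiffOn ℝ 2 (N σ) Disc)
    (hNXu : ∀ σ, ∀ p ∈ Disc, ⟪pdu X p, N σ p⟫ = 0)
    (hNXv : ∀ σ, ∀ p ∈ Disc, ⟪pdv X p, N σ p⟫ = 0)
    (hNN : ∀ σ ω, ∀ p ∈ Disc, ⟪N σ p, N ω p⟫ = if σ = ω then 1 else 0)
    -- X is minimal: `H_σ ≡ 0` for all `σ`
    (hminimal : ∀ σ, ∀ p ∈ Disc, (L11 X (N σ) p + L22 X (N σ) p) / (2 * W p) = 0)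
    -- the orthonormal normal section is torsion-free
    (htorsionfree : ∀ σ ω, ∀ p ∈ Disc, Tor1 N σ ω p = 0 ∧ Tor2 N σ ω p = 0)
    -- K does not vanish identically on B
    (hKnontrivial : ¬ ∀ p ∈ Disc,
      (∑ σ, (L11 X (N σ) p * L22 X (N σ) p - (L12 X (N σ) p) ^ 2) / (W p) ^ 2) = 0)
    : ∀ z ∈ Metric.ball (0 : ℝ × ℝ) 1,
      ¬ AccPt z (Filter.principal
          {q | q ∈ Metric.ball (0 : ℝ × ℝ) 1 ∧
            (∑ σ, (L11 X (N σ) q * L22 X (N σ) q - (L12 X (N σ) q) ^ 2) / (W q) ^ 2) = 0}) := by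
  have hball : interior Disc = Metric.ball (0 : ℝ × ℝ) 1 := interior_closedBall _ one_ne_zero
  have hball' : (interior Disc).Nonempty := by
    rw [hball]
    exact Metric.nonempty_ball.mpr one_pos
  have hconvex : Convex ℝ Disc := convex_closedBall _ _
  have hsub : Metric.ball (0 : ℝ × ℝ) 1 ⊆ Disc := Metric.ball_subset_closedBall
  have hopen : IsOpen (Metric.ball (0 : ℝ × ℝ) 1) := Metric.isOpen_ball
  have hmin : ∀ σ, ∀ p ∈ Disc, L11 X (N σ) p + L22 X (N σ) p = 0 := fun σ p hp =>
    (div_eq_zero_iff.mp (hminimal σ p hp)).resolve_right (by linarith [hWpos p hp])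
  have hK : ∀ p ∈ Disc,
      ((∑ σ, (L11 X (N σ) p * L22 X (N σ) p - (L12 X (N σ) p) ^ 2) / (W p) ^ 2) = 0 ↔
        ∀ σ, L11 X (N σ) p = 0 ∧ L12 X (N σ) p = 0) := by
    intro p hp
    have hW := hWpos p hp
    have hterm : ∀ σ, (L11 X (N σ) p * L22 X (N σ) p - (L12 X (N σ) p) ^ 2) / (W p) ^ 2
        = -(((L11 X (N σ) p) ^ 2 + (L12 X (N σ) p) ^ 2) / (W p) ^ 2) := fun σ => by
      rw [eq_neg_of_add_eq_zero_right (hmin σ p hp)]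
      ring
    simp only [hterm, Finset.sum_neg_distrib, neg_eq_zero]
    rw [Finset.sum_eq_zero_iff_of_nonneg fun σ _ => by positivity]
    refine ⟨fun h σ => ?_, fun h σ _ => by simp [h σ]⟩
    have hσ := (div_eq_zero_iff.mp (h σ (Finset.mem_univ σ))).resolve_right (by positivity)
    constructor <;> nlinarith [sq_nonneg (L11 X (N σ) p), sq_nonneg (L12 X (N σ) p)]
  intro z hz hacc
  rw [accPt_iff_frequently_nhdsNE] at hacc
  have hXb : ContDiffOn ℝ 3 X (Metric.ball 0 1) := hX.mono hsub
  have hXu : ContDiffOn ℝ 2 (pdu X) (Metric.ball 0 1) := hXb.pdu hopen (by norm_num)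
  have hNb (σ) : DifferentiableOn ℝ (N σ) (Metric.ball 0 1) :=
    ((hN σ).mono hsub).differentiableOn two_ne_zero
  have hzero : ∀ σ, ∀ q ∈ Metric.ball (0 : ℝ × ℝ) 1,
      L11 X (N σ) q = 0 ∧ L12 X (N σ) q = 0 := by
    intro σ
    have hcod {p} (hp : p ∈ Metric.ball (0 : ℝ × ℝ) 1) :=
      codazzi_of_minimal_torsionfree hopen hXb (fun p hp => hWpos p (hsub hp))
        (fun p hp => hconfu p (hsub hp)) (fun p hp => hconfv p (hsub hp))
        (fun p hp => hconfuv p (hsub hp)) hNb (fun σ p hp => hNXu σ p (hsub hp))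
        (fun σ p hp => hNXv σ p (hsub hp)) (fun σ ω p hp => hNN σ ω p (hsub hp))
        (fun σ p hp => hmin σ p (hsub hp)) (fun σ ω p hp => htorsionfree σ ω p (hsub hp)) σ hp
    have hd11 : DifferentiableOn ℝ (L11 X (N σ)) (Metric.ball 0 1) :=
      ((hXu.pdu hopen (k := 1) (by norm_num)).differentiableOn one_ne_zero).inner ℝ (hNb σ)
    have hd12 : DifferentiableOn ℝ (L12 X (N σ)) (Metric.ball 0 1) :=
      ((hXu.pdv hopen (k := 1) (by norm_num)).differentiableOn one_ne_zero).inner ℝ (hNb σ)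
    have hL22 : Set.EqOn (L22 X (N σ)) (fun q => -L11 X (N σ) q) (Metric.ball 0 1) :=
      fun q hq => eq_neg_of_add_eq_zero_right (hmin σ q (hsub hq))
    have hneg := eqOn_zero_of_cauchyRiemann_of_frequently_eq_zero (a := L12 X (N σ))
      (b := L11 X (N σ)) hopen (convex_ball _ _).isPreconnected hd12 hd11
      (fun p hp => (hcod hp).1.symm)
      (fun p hp => by
        rw [(hcod hp).2, pdu_congr hopen hL22 hp]
        simp [pdu, fderiv_fun_neg])
      hz (hacc.mono fun q hq => ((hK q (hsub hq.1)).mp hq.2 σ).symm)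
    exact fun q hq => (hneg q hq).symm
  refine hKnontrivial fun p hp => (hK p hp).mpr fun σ => ?_
  have hdiff : ∀ q ∈ Disc, DifferentiableAt ℝ X q := fun q hq => by
    by_contra hnd
    have := hconfu q hq
    simp only [pdu, fderiv_zero_of_not_differentiableAt hnd, zero_apply,
      inner_zero_left] at this
    exact (hWpos q hq).ne this
  have huniq : UniqueDiffOn ℝ Disc := uniqueDiffOn_convex hconvex hball'
  have hXuD : ContDiffOn ℝ 1 (pdu X) Disc :=
    ((hX.fderivWithin huniq (m := 1) (by norm_num)).clm_apply contDiffOn_const).congr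
      fun q hq => by rw [pdu, (hdiff q hq).fderivWithin (huniq q hq)]
  exact ⟨inner_fderiv_eq_zero_of_interior hconvex hball' hXuD (hN σ).continuousOn
      (fun q hq => (hzero σ q (hball ▸ hq)).1) hp,
    inner_fderiv_eq_zero_of_interior hconvex hball' hXuD (hN σ).continuousOn
      (fun q hq => (hzero σ q (hball ▸ hq)).2) hp⟩
end
end
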